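/- If F and G are functions of Hilbert-Schmidt type on W = H ⊕ H*, then their canonical Poisson bracket {F,G} = ⟨D₁F, D₂G⟩ − ⟨D₁G, D₂F⟩ is again of Hilbert-Schmidt type. Hence (W, F_HS, {·,·}) is a Poisson space. -/

import Mathlib

noncomputable section

variable {𝕜 : Type*} [RCLike 𝕜]
variable {H : Type*} [NormedAddCommGroup H] [InnerProductSpace 𝕜 H]

/-- Basis directions in `W = H ⊕ H*`: `(e_i, 0)` for `α = true` ("index `i`") and
`(0, e_i*)` for `α = false` ("index `i*`"), where `e_i* = ⟨e_i, ·⟩`. -/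
def dirVec (b : HilbertBasis ℕ 𝕜 H) (α : Bool) (i : ℕ) : H × (H →L[𝕜] 𝕜) :=
  if α then ((b i : H), 0) else (0, innerSL 𝕜 (b i))

/-- A function `F : W → 𝕜` on `W = H ⊕ H*` is of Hilbert-Schmidt type if it is Fréchet-smooth
and, for every `r ≥ 1`, every choice of directions (in `H` or `H*`) and every point `w`, the
family of `r`-th partial derivatives along basis directions is square-summable. -/
def IsHS (b : HilbertBasis ℕ 𝕜 H) (F : H × (H →L[𝕜] 𝕜) → 𝕜) : Prop :=
  ContDiff 𝕜 (⊤ : ℕ∞) F ∧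
  ∀ r : ℕ, 0 < r → ∀ (α : Fin r → Bool) (w : H × (H →L[𝕜] 𝕜)),
    Summable fun I : Fin r → ℕ =>
      ‖iteratedFDeriv 𝕜 r F w (fun k => dirVec b (α k) (I k))‖ ^ 2

/-- First partial Fréchet derivative `D₁F(x,η) ∈ H*` on `W = H ⊕ H*`. -/
def D1 (F : H × (H →L[𝕜] 𝕜) → 𝕜) (w : H × (H →L[𝕜] 𝕜)) : H →L[𝕜] 𝕜 :=
  (fderiv 𝕜 F w).comp (ContinuousLinearMap.inl 𝕜 H (H →L[𝕜] 𝕜))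

/-- Second partial Fréchet derivative `D₂F(x,η) ∈ H** ≅ H` on `W = H ⊕ H*`. -/
def D2 (F : H × (H →L[𝕜] 𝕜) → 𝕜) (w : H × (H →L[𝕜] 𝕜)) : (H →L[𝕜] 𝕜) →L[𝕜] 𝕜 :=
  (fderiv 𝕜 F w).comp (ContinuousLinearMap.inr 𝕜 H (H →L[𝕜] 𝕜))

/-- The canonical Poisson bracket `{F,G} = ⟨D₁F, D₂G⟩ − ⟨D₁G, D₂F⟩` on `W = H ⊕ H*`. -/
def pbracket (F G : H × (H →L[𝕜] 𝕜) → 𝕜) (w : H × (H →L[𝕜] 𝕜)) : 𝕜 :=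
  D2 G w (D1 F w) - D2 F w (D1 G w)

set_option maxSynthPendingDepth 6
set_option synthInstance.maxHeartbeats 200000

/-- Order-`r` square summability of a family of functions. -/
def HSOrd (b : HilbertBasis ℕ 𝕜 H) {ι : Type} (f : ι → H × (H →L[𝕜] 𝕜) → 𝕜) (r : ℕ) : Prop :=
  ∀ (α : Fin r → Bool) (w : H × (H →L[𝕜] 𝕜)),
    Summable fun p : ι × (Fin r → ℕ) =>
      ‖iteratedFDeriv 𝕜 r (f p.1) w (fun k => dirVec b (α k) (p.2 k))‖ ^ 2

/-- The family of partial derivatives of a family of functions. -/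
def pdFam (b : HilbertBasis ℕ 𝕜 H) {ι : Type} (f : ι → H × (H →L[𝕜] 𝕜) → 𝕜) (a : Bool) :
    ι × ℕ → H × (H →L[𝕜] 𝕜) → 𝕜 :=
  fun p w => fderiv 𝕜 (f p.1) w (dirVec b a p.2)

/-- The bilinear pairing on first derivatives. -/
def pairB (𝕜 : Type*) [RCLike 𝕜] (H : Type*) [NormedAddCommGroup H] [InnerProductSpace 𝕜 H] :
    ((H × (H →L[𝕜] 𝕜)) →L[𝕜] 𝕜) →L[𝕜] ((H × (H →L[𝕜] 𝕜)) →L[𝕜] 𝕜) →L[𝕜] 𝕜 :=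
  (ContinuousLinearMap.apply 𝕜 𝕜).comp
    ((ContinuousLinearMap.inr 𝕜 H (H →L[𝕜] 𝕜)).comp
      ((ContinuousLinearMap.compL 𝕜 H (H × (H →L[𝕜] 𝕜)) 𝕜).flip
        (ContinuousLinearMap.inl 𝕜 H (H →L[𝕜] 𝕜))))

theorem pairB_apply (φ ψ : (H × (H →L[𝕜] 𝕜)) →L[𝕜] 𝕜) :
    pairB 𝕜 H φ ψ = ψ (0, φ.comp (ContinuousLinearMap.inl 𝕜 H (H →L[𝕜] 𝕜))) := rfl

theorem pbracket_eq (F G : H × (H →L[𝕜] 𝕜) → 𝕜) (w : H × (H →L[𝕜] 𝕜)) :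
    pbracket F G w = pairB 𝕜 H (fderiv 𝕜 F w) (fderiv 𝕜 G w)
      - pairB 𝕜 H (fderiv 𝕜 G w) (fderiv 𝕜 F w) := rfl

theorem iteratedFDeriv_succ_dir {W : Type*} [NormedAddCommGroup W] [NormedSpace 𝕜 W]
    {f : W → 𝕜} (hf : ContDiff 𝕜 (⊤ : ℕ∞) f) (r : ℕ) (w : W) (m : Fin (r + 1) → W) :
    iteratedFDeriv 𝕜 (r + 1) f w m
      = iteratedFDeriv 𝕜 r (fun y => fderiv 𝕜 f y (m (Fin.last r))) w (Fin.init m) := by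
  rw [iteratedFDeriv_succ_apply_right]
  have hd : ContDiff 𝕜 (r : WithTop ℕ∞) (fun y => fderiv 𝕜 f y) := by
    apply hf.fderiv_right
    exact_mod_cast le_top
  have := ContinuousLinearMap.iteratedFDeriv_comp_left
    (ContinuousLinearMap.apply 𝕜 𝕜 (m (Fin.last r))) (hd.contDiffAt (x := w)) (i := r) le_rfl
  have h2 : (fun y => fderiv 𝕜 f y (m (Fin.last r)))
    = (ContinuousLinearMap.apply 𝕜 𝕜 (m (Fin.last r))) ∘ (fun y => fderiv 𝕜 f y) := rfl
  rw [h2, this]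
  rfl

theorem contDiff_pd {W : Type*} [NormedAddCommGroup W] [NormedSpace 𝕜 W]
    {f : W → 𝕜} (hf : ContDiff 𝕜 (⊤ : ℕ∞) f) (v : W) :
    ContDiff 𝕜 (⊤ : ℕ∞) (fun y => fderiv 𝕜 f y v) := by
  have hd : ContDiff 𝕜 (⊤ : ℕ∞) (fun y => fderiv 𝕜 f y) := hf.fderiv_right (by simp)
  exact hd.clm_apply contDiff_const

theorem fderiv_fderiv_dir {W : Type*} [NormedAddCommGroup W] [NormedSpace 𝕜 W]
    {f : W → 𝕜} (hf : ContDiff 𝕜 (⊤ : ℕ∞) f) (v w : W) :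
    fderiv 𝕜 (fderiv 𝕜 f) w v = fderiv 𝕜 (fun y => fderiv 𝕜 f y v) w := by
  have hd : ContDiff 𝕜 (⊤ : ℕ∞) (fderiv 𝕜 f) := hf.fderiv_right (by simp)
  have hdw : DifferentiableAt 𝕜 (fderiv 𝕜 f) w := (hd.differentiable (by simp)) w
  have hs : IsSymmSndFDerivAt 𝕜 f w := by
    apply hf.contDiffAt.isSymmSndFDerivAt
    rw [minSmoothness_of_isRCLikeNormedField]
    exact WithTop.coe_le_coe.2 (le_top : (2 : ℕ∞) ≤ ⊤)
  ext u
  rw [fderiv_clm_apply hdw (differentiableAt_const v)]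
  simpa using hs.eq v u

theorem contDiff_pair {f g : H × (H →L[𝕜] 𝕜) → 𝕜} (hf : ContDiff 𝕜 (⊤ : ℕ∞) f)
    (hg : ContDiff 𝕜 (⊤ : ℕ∞) g) :
    ContDiff 𝕜 (⊤ : ℕ∞) (fun w => pairB 𝕜 H (fderiv 𝕜 f w) (fderiv 𝕜 g w)) := by
  have hdf : ContDiff 𝕜 (⊤ : ℕ∞) (fderiv 𝕜 f) := hf.fderiv_right (by simp)
  have hdg : ContDiff 𝕜 (⊤ : ℕ∞) (fderiv 𝕜 g) := hg.fderiv_right (by simp)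
  exact ((pairB 𝕜 H).contDiff.comp hdf).clm_apply hdg

theorem fderiv_pair {f g : H × (H →L[𝕜] 𝕜) → 𝕜} (hf : ContDiff 𝕜 (⊤ : ℕ∞) f)
    (hg : ContDiff 𝕜 (⊤ : ℕ∞) g) (w v : H × (H →L[𝕜] 𝕜)) :
    fderiv 𝕜 (fun w => pairB 𝕜 H (fderiv 𝕜 f w) (fderiv 𝕜 g w)) w v
      = pairB 𝕜 H (fderiv 𝕜 (fun y => fderiv 𝕜 f y v) w) (fderiv 𝕜 g w)
        + pairB 𝕜 H (fderiv 𝕜 f w) (fderiv 𝕜 (fun y => fderiv 𝕜 g y v) w) := by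
  have hdf : ContDiff 𝕜 (⊤ : ℕ∞) (fderiv 𝕜 f) := hf.fderiv_right (by simp)
  have hdg : ContDiff 𝕜 (⊤ : ℕ∞) (fderiv 𝕜 g) := hg.fderiv_right (by simp)
  rw [← fderiv_fderiv_dir hf, ← fderiv_fderiv_dir hg]
  have := (pairB 𝕜 H).hasFDerivAt_of_bilinear
    ((hdf.differentiable (by simp)) w).hasFDerivAt ((hdg.differentiable (by simp)) w).hasFDerivAt
  rw [this.fderiv]
  simp [add_comm]

theorem hasSum_pairB (b : HilbertBasis ℕ 𝕜 H) (φ ψ : (H × (H →L[𝕜] 𝕜)) →L[𝕜] 𝕜) :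
    HasSum (fun i => φ (dirVec b true i) * ψ (dirVec b false i)) (pairB 𝕜 H φ ψ) := by
  have hc : CompleteSpace H :=
    (completeSpace_congr (e := b.repr.toEquiv) b.repr.isometry.isUniformEmbedding).2 inferInstance
  set x : H →L[𝕜] 𝕜 := φ.comp (ContinuousLinearMap.inl 𝕜 H (H →L[𝕜] 𝕜)) with hx
  have h1 := b.hasSum_repr ((InnerProductSpace.toDual 𝕜 H).symm x)
  have h2 := h1.map (InnerProductSpace.toDual 𝕜 H) (InnerProductSpace.toDual 𝕜 H).continuous
  have h3 := h2.map (ψ.comp (ContinuousLinearMap.inr 𝕜 H (H →L[𝕜] 𝕜)))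
    (ContinuousLinearMap.continuous _)
  rw [LinearIsometryEquiv.apply_symm_apply] at h3
  rw [pairB_apply]
  convert h3 using 1
  · funext i
    have e1 : (starRingEnd 𝕜) (b.repr ((InnerProductSpace.toDual 𝕜 H).symm x) i)
        = φ (dirVec b true i) := by
      rw [b.repr_apply_apply, inner_conj_symm, InnerProductSpace.toDual_symm_apply, hx]
      simp [dirVec]
    have e2 : ψ (dirVec b false i)
      = (ψ.comp (ContinuousLinearMap.inr 𝕜 H (H →L[𝕜] 𝕜))) (InnerProductSpace.toDual 𝕜 H (b i)) := by
      simp only [dirVec]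
      rfl
    simp only [Function.comp_apply]
    rw [LinearIsometryEquiv.map_smulₛₗ, map_smul, e1, e2, smul_eq_mul]
  · rfl

theorem norm_pairB_sq_le (b : HilbertBasis ℕ 𝕜 H) (φ ψ : (H × (H →L[𝕜] 𝕜)) →L[𝕜] 𝕜)
    (hφ : Summable fun i => ‖φ (dirVec b true i)‖ ^ 2)
    (hψ : Summable fun i => ‖ψ (dirVec b false i)‖ ^ 2) :
    ‖pairB 𝕜 H φ ψ‖ ^ 2
      ≤ (∑' i, ‖φ (dirVec b true i)‖ ^ 2) * (∑' i, ‖ψ (dirVec b false i)‖ ^ 2) := by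
  have h := hasSum_pairB b φ ψ
  have h' := (h.norm.pow 2)
  refine le_of_tendsto h' (Filter.Eventually.of_forall fun s => ?_)
  calc ‖∑ i ∈ s, φ (dirVec b true i) * ψ (dirVec b false i)‖ ^ 2
      ≤ (∑ i ∈ s, ‖φ (dirVec b true i)‖ * ‖ψ (dirVec b false i)‖) ^ 2 := by
        gcongr
        refine (norm_sum_le _ _).trans (le_of_eq ?_)
        simp
    _ ≤ (∑ i ∈ s, ‖φ (dirVec b true i)‖ ^ 2) * (∑ i ∈ s, ‖ψ (dirVec b false i)‖ ^ 2) :=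
        Finset.sum_mul_sq_le_sq_mul_sq _ _ _
    _ ≤ _ := by
        gcongr
        · exact hφ.sum_le_tsum _ fun _ _ => by positivity
        · exact hψ.sum_le_tsum _ fun _ _ => by positivity

theorem summable_sq_add {ι : Type*} {u v : ι → 𝕜} (hu : Summable fun i => ‖u i‖ ^ 2)
    (hv : Summable fun i => ‖v i‖ ^ 2) : Summable fun i => ‖u i + v i‖ ^ 2 := by
  refine Summable.of_nonneg_of_le (fun _ => by positivity) (fun i => ?_)
    ((hu.add hv).mul_left 2)
  have := norm_add_le (u i) (v i)
  nlinarith [sq_nonneg (‖u i‖ - ‖v i‖), norm_nonneg (u i + v i), norm_nonneg (u i),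
    norm_nonneg (v i)]

theorem hsOrd_succ_iff (b : HilbertBasis ℕ 𝕜 H) {ι : Type} {f : ι → H × (H →L[𝕜] 𝕜) → 𝕜}
    (hf : ∀ i, ContDiff 𝕜 (⊤ : ℕ∞) (f i)) (r : ℕ) :
    HSOrd b f (r + 1) ↔ ∀ a, HSOrd b (pdFam b f a) r := by
  let e : (ι × ℕ) × (Fin r → ℕ) ≃ ι × (Fin (r + 1) → ℕ) :=
    (Equiv.prodAssoc _ _ _).trans
      (Equiv.prodCongr (Equiv.refl ι) (Fin.snocEquiv (fun _ : Fin (r + 1) => ℕ)))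
  have key : ∀ (α : Fin (r + 1) → Bool) (w : H × (H →L[𝕜] 𝕜)) (p : (ι × ℕ) × (Fin r → ℕ)),
      iteratedFDeriv 𝕜 (r + 1) (f (e p).1) w (fun k => dirVec b (α k) ((e p).2 k))
      = iteratedFDeriv 𝕜 r (pdFam b f (α (Fin.last r)) p.1) w
          (fun k => dirVec b (Fin.init α k) (p.2 k)) := by
    intro α w p
    rw [iteratedFDeriv_succ_dir (hf _)]
    have h1 : (e p).2 (Fin.last r) = p.1.2 := by simp [e, Fin.snocEquiv]
    have h2 : ∀ k : Fin r, (e p).2 k.castSucc = p.2 k := by intro k; simp [e, Fin.snocEquiv]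
    rw [h1]
    congr 1
    funext k
    simp only [Fin.init, h2]
  constructor
  · intro h a α w
    have := (e.summable_iff (f := fun p : ι × (Fin (r + 1) → ℕ) => _)).2
      (h (Fin.snoc α a) w)
    refine this.congr fun p => ?_
    simp only [Function.comp_apply]
    rw [key]
    simp
  · intro h α w
    rw [← e.summable_iff]
    refine (h (α (Fin.last r)) (Fin.init α) w).congr fun p => ?_
    simp only [Function.comp_apply]
    rw [key]

theorem hsOrd_pair (b : HilbertBasis ℕ 𝕜 H) (r : ℕ) : ∀ {ι κ : Type}
    {f : ι → H × (H →L[𝕜] 𝕜) → 𝕜} {g : κ → H × (H →L[𝕜] 𝕜) → 𝕜}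
    (_ : ∀ i, ContDiff 𝕜 (⊤ : ℕ∞) (f i)) (_ : ∀ i, ContDiff 𝕜 (⊤ : ℕ∞) (g i))
    (_ : ∀ n, HSOrd b f (n + 1)) (_ : ∀ n, HSOrd b g (n + 1)),
    HSOrd b (fun (p : ι × κ) w => pairB 𝕜 H (fderiv 𝕜 (f p.1) w) (fderiv 𝕜 (g p.2) w)) r := by
  induction r with
  | zero =>
    intro ι κ f g hf hg hF hG α w
    have aux : ∀ {ι : Type} {f : ι → H × (H →L[𝕜] 𝕜) → 𝕜},
        (∀ i, ContDiff 𝕜 (⊤ : ℕ∞) (f i)) → HSOrd b f 1 → ∀ a,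
        Summable fun p : ι × ℕ => ‖fderiv 𝕜 (f p.1) w (dirVec b a p.2)‖ ^ 2 := by
      intro ι f hf h a
      have := (hsOrd_succ_iff b hf 0).1 h a Fin.elim0 w
      have := this.comp_injective (i := fun p : ι × ℕ => (p, Fin.elim0))
        (fun p q h => (Prod.mk.inj h).1)
      simpa [Function.comp_def, pdFam] using this
    have sf := aux hf (hF 0) true
    have sg := aux hg (hG 0) false
    have hprod := sf.prod.mul_of_nonneg sg.prod (fun i => tsum_nonneg fun _ => by positivity)
      (fun i => tsum_nonneg fun _ => by positivity)
    let e : (ι × κ) × (Fin 0 → ℕ) ≃ ι × κ := Equiv.prodUnique _ _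
    refine Summable.of_nonneg_of_le (fun _ => by positivity) (fun p => ?_)
      ((e.summable_iff).2 hprod)
    simp only [iteratedFDeriv_zero_apply]
    exact norm_pairB_sq_le b _ _ (sf.prod_factor p.1.1) (sg.prod_factor p.1.2)
  | succ r ih =>
    intro ι κ f g hf hg hF hG
    rw [hsOrd_succ_iff b (fun p => contDiff_pair (hf _) (hg _))]
    intro a α w
    have hpf : ∀ p, ContDiff 𝕜 (⊤ : ℕ∞) (pdFam b f a p) := fun p => contDiff_pd (hf _) _
    have hpg : ∀ p, ContDiff 𝕜 (⊤ : ℕ∞) (pdFam b g a p) := fun p => contDiff_pd (hg _) _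
    have A := ih hpf hg (fun n => (hsOrd_succ_iff b hf (n + 1)).1 (hF (n + 1)) a) hG α w
    have B := ih hf hpg hF (fun n => (hsOrd_succ_iff b hg (n + 1)).1 (hG (n + 1)) a) α w
    have A' := A.comp_injective
      (i := fun p : ((ι × κ) × ℕ) × (Fin r → ℕ) => (((p.1.1.1, p.1.2), p.1.1.2), p.2))
      (by rintro ⟨⟨⟨_, _⟩, _⟩, _⟩ ⟨⟨⟨_, _⟩, _⟩, _⟩ h; simp at h ⊢; tauto)
    have B' := B.comp_injective
      (i := fun p : ((ι × κ) × ℕ) × (Fin r → ℕ) => ((p.1.1.1, (p.1.1.2, p.1.2)), p.2))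
      (by rintro ⟨⟨⟨_, _⟩, _⟩, _⟩ ⟨⟨⟨_, _⟩, _⟩, _⟩ h; simp at h ⊢; tauto)
    refine (summable_sq_add A' B').congr fun p => ?_
    have e1 : pdFam b (fun (p : ι × κ) w =>
          pairB 𝕜 H (fderiv 𝕜 (f p.1) w) (fderiv 𝕜 (g p.2) w)) a p.1
        = (fun w => pairB 𝕜 H (fderiv 𝕜 (pdFam b f a (p.1.1.1, p.1.2)) w)
            (fderiv 𝕜 (g p.1.1.2) w))
          + (fun w => pairB 𝕜 H (fderiv 𝕜 (f p.1.1.1) w)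
            (fderiv 𝕜 (pdFam b g a (p.1.1.2, p.1.2)) w)) := by
      funext y
      exact fderiv_pair (hf _) (hg _) y _
    rw [e1, iteratedFDeriv_add_apply
      ((contDiff_pair (hpf _) (hg _)).contDiffAt.of_le (by exact_mod_cast le_top))
      ((contDiff_pair (hf _) (hpg _)).contDiffAt.of_le (by exact_mod_cast le_top))]
    rfl

theorem summable_pair (b : HilbertBasis ℕ 𝕜 H)
    (F G : H × (H →L[𝕜] 𝕜) → 𝕜) (hF : IsHS b F) (hG : IsHS b G)
    (r : ℕ) (α : Fin r → Bool) (w : H × (H →L[𝕜] 𝕜)) :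
    Summable fun I : Fin r → ℕ =>
      ‖iteratedFDeriv 𝕜 r (fun w => pairB 𝕜 H (fderiv 𝕜 F w) (fderiv 𝕜 G w)) w
        (fun k => dirVec b (α k) (I k))‖ ^ 2 := by
  have aux : ∀ {F : H × (H →L[𝕜] 𝕜) → 𝕜}, IsHS b F → ∀ n,
      HSOrd b (fun _ : Unit => F) (n + 1) := by
    intro F hF n α w
    have h := hF.2 (n + 1) n.succ_pos α w
    have h2 := h.comp_injective (i := fun p : Unit × (Fin (n + 1) → ℕ) => p.2)
      (by rintro ⟨_, _⟩ ⟨_, _⟩ h; simpa using h)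
    exact h2
  have := hsOrd_pair b r (fun _ => hF.1) (fun _ => hG.1) (aux hF) (aux hG) α w
  exact this.comp_injective (i := fun I : Fin r → ℕ => (((), ()), I))
    (fun p q h => (Prod.mk.inj h).2)

/-- if `F` and `G` are of Hilbert-Schmidt type on `W = H ⊕ H*`, so is their
canonical Poisson bracket `{F,G}`; hence `(W, F_HS, {·,·})` is a Poisson space. -/
theorem isHS_pbracket (b : HilbertBasis ℕ 𝕜 H)
    (F G : H × (H →L[𝕜] 𝕜) → 𝕜) (hF : IsHS b F) (hG : IsHS b G) :
    IsHS b (pbracket F G) := by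
  have e : pbracket F G = (fun w => pairB 𝕜 H (fderiv 𝕜 F w) (fderiv 𝕜 G w))
      - (fun w => pairB 𝕜 H (fderiv 𝕜 G w) (fderiv 𝕜 F w)) := rfl
  have c1 := contDiff_pair hF.1 hG.1
  have c2 := contDiff_pair hG.1 hF.1
  refine ⟨e ▸ c1.sub c2, fun r _ α w => ?_⟩
  have s1 := summable_pair b F G hF hG r α w
  have s2 := summable_pair b G F hG hF r α w
  refine (summable_sq_add s1 (s2.congr fun I => (congrArg (· ^ 2) (norm_neg _)).symm)).congr fun I => ?_
  rw [e, iteratedFDeriv_sub_apply (c1.contDiffAt.of_le (by exact_mod_cast le_top))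
    (c2.contDiffAt.of_le (by exact_mod_cast le_top)), sub_apply,
    sub_eq_add_neg]

end
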